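/- Let H be a complex Hilbert space, let A be a bounded self-adjoint operator on H, let B be a bounded operator on H, let n ≥ 1, and let g : ℝ → ℂ be measurable with ∫_ℝ |g(s)| |s|^k ds < ∞ for all 0 ≤ k ≤ n. With f_g(A) := ∫_ℝ g(s) exp(isA) ds and f_g^(k)(A) := ∫_ℝ g(s) (is)^k exp(isA) ds, one has ‖ [B, f_g(A)] − Σ_{k=1}^{n−1} ((−1)^{k−1}/k!) · ad_A^(k)(B) · f_g^(k)(A) ‖ ≤ (1/n!) · ‖ad_A^(n)(B)‖ · ∫_ℝ |g(s)| |s|^n ds. -/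

import Mathlib

open scoped Complex
open MeasureTheory

/-- Iterated commutator: `ad_A^(0)(B) = B`, `ad_A^(k)(B) = [ad_A^(k-1)(B), A]`. -/
def adIter {H : Type*} [NormedAddCommGroup H] [InnerProductSpace ℂ H] [CompleteSpace H]
    (A B : H →L[ℂ] H) : ℕ → (H →L[ℂ] H)
  | 0 => B
  | k + 1 => adIter A B k * A - A * adIter A B k

section Helpers

variable {H : Type*} [NormedAddCommGroup H] [InnerProductSpace ℂ H] [CompleteSpace H]

/-- The unitary group. -/
noncomputable def eGrp (A : H →L[ℂ] H) (s : ℝ) : H →L[ℂ] H :=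
  NormedSpace.exp ((Complex.I * s) • A)

/-- The Taylor remainder. -/
noncomputable def tRem (A B : H →L[ℂ] H) (m : ℕ) (s : ℝ) : H →L[ℂ] H :=
  eGrp A s * B * eGrp A (-s) -
    ∑ k ∈ Finset.range m, ((-(Complex.I * s)) ^ k * ((k.factorial : ℂ))⁻¹) • adIter A B k

theorem adIter_shift (A B : H →L[ℂ] H) (k : ℕ) :
    adIter A (B * A - A * B) k = adIter A B (k + 1) := by
  induction k with
  | zero => rfl
  | succ k ih =>
    rw [adIter, ih]; rfl

theorem eGrp_eq (A : H →L[ℂ] H) :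
    eGrp A = fun s : ℝ => NormedSpace.exp (s • (Complex.I • A)) := by
  funext s
  rw [eGrp, ← Complex.coe_smul s (Complex.I • A), smul_smul, mul_comm]

theorem eGrp_mem (A : H →L[ℂ] H) (hA : IsSelfAdjoint A) (s : ℝ) :
    eGrp A s ∈ unitary (H →L[ℂ] H) := by
  let +nondep : NormedAlgebra ℚ (H →L[ℂ] H) := .restrictScalars ℚ ℂ (H →L[ℂ] H)
  apply NormedSpace.exp_mem_unitary_of_mem_skewAdjoint
  apply hA.smul_mem_skewAdjoint
  rw [skewAdjoint.mem_iff]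
  simp

theorem eGrp_neg_mul (A : H →L[ℂ] H) (s : ℝ) : eGrp A (-s) * eGrp A s = 1 := by
  let +nondep : NormedAlgebra ℚ (H →L[ℂ] H) := .restrictScalars ℚ ℂ (H →L[ℂ] H)
  unfold eGrp
  rw [← NormedSpace.exp_add_of_commute]
  · simp
  · exact ((Commute.refl A).smul_left _).smul_right _

theorem eGrp_deriv (A : H →L[ℂ] H) (s : ℝ) :
    HasDerivAt (eGrp A) (eGrp A s * (Complex.I • A)) s := by
  rw [eGrp_eq]
  exact hasDerivAt_exp_smul_const (𝕂 := ℝ) (Complex.I • A) s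

theorem eGrp_deriv' (A : H →L[ℂ] H) (s : ℝ) :
    HasDerivAt (eGrp A) ((Complex.I • A) * eGrp A s) s := by
  rw [eGrp_eq]
  exact hasDerivAt_exp_smul_const' (𝕂 := ℝ) (Complex.I • A) s

theorem eGrp_norm (A : H →L[ℂ] H) (hA : IsSelfAdjoint A) (s : ℝ) : ‖eGrp A s‖ ≤ 1 := by
  have h := CStarRing.norm_mem_unitary_mul (1 : H →L[ℂ] H) (eGrp_mem A hA s)
  rw [mul_one] at h
  rw [h]
  exact ContinuousLinearMap.norm_id_le

theorem coef_deriv (k : ℕ) (s : ℝ) :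
    HasDerivAt (fun s : ℝ => (-(Complex.I * s)) ^ (k + 1) * (((k + 1).factorial : ℂ))⁻¹)
      (-Complex.I * ((-(Complex.I * s)) ^ k * ((k.factorial : ℂ))⁻¹)) s := by
  have h1 : HasDerivAt (fun s : ℝ => -(Complex.I * (s : ℂ))) (-Complex.I) s := by
    have := (Complex.ofRealCLM.hasDerivAt (x := s)).const_mul Complex.I
    simpa using! this.neg
  have h2 := (h1.pow (k + 1)).mul_const (((k + 1).factorial : ℂ))⁻¹
  refine h2.congr_deriv ?_
  have : ((k : ℂ) + 1) ≠ 0 := Nat.cast_add_one_ne_zero k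
  have : (k.factorial : ℂ) ≠ 0 := by exact_mod_cast k.factorial_ne_zero
  rw [Nat.factorial_succ]
  push_cast
  field_simp

theorem tRem_deriv (A B : H →L[ℂ] H) (m : ℕ) (s : ℝ) :
    HasDerivAt (tRem A B (m + 1)) ((-Complex.I) • tRem A (B * A - A * B) m s) s := by
  have hneg : HasDerivAt (fun s : ℝ => eGrp A (-s)) (-((Complex.I • A) * eGrp A (-s))) s := by
    have h := (eGrp_deriv' A (-s)).scomp s (hasDerivAt_neg s)
    simpa [Function.comp_def] using! h
  have h1 := ((eGrp_deriv A s).mul_const B).mul hneg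
  have h2 : HasDerivAt (fun s : ℝ => ∑ k ∈ Finset.range m,
      ((-(Complex.I * s)) ^ (k + 1) * (((k + 1).factorial : ℂ))⁻¹) • adIter A B (k + 1))
      (∑ k ∈ Finset.range m, (-Complex.I * ((-(Complex.I * s)) ^ k * ((k.factorial : ℂ))⁻¹)) •
        adIter A B (k + 1)) s := by
    apply HasDerivAt.fun_sum
    intro k _
    exact (coef_deriv k s).smul_const _
  have h3 := (h1.sub h2).sub_const B
  have e : tRem A B (m + 1) = fun s : ℝ => eGrp A s * B * eGrp A (-s) - (∑ k ∈ Finset.range m,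
      ((-(Complex.I * s)) ^ (k + 1) * (((k + 1).factorial : ℂ))⁻¹) • adIter A B (k + 1)) - B := by
    funext t
    rw [tRem, Finset.sum_range_succ']
    simp only [pow_zero, Nat.factorial_zero, Nat.cast_one, inv_one, mul_one, one_smul, adIter]
    abel
  rw [e]
  refine h3.congr_deriv ?_
  rw [tRem, smul_sub, Finset.smul_sum]
  simp only [adIter_shift, smul_smul]
  congr 1
  simp only [mul_sub, sub_mul, smul_sub, mul_smul_comm, smul_mul_assoc, neg_smul, mul_neg, mul_assoc]
  abel

theorem tRem_zero (A B : H →L[ℂ] H) (m : ℕ) : tRem A B (m + 1) 0 = 0 := by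
  rw [tRem, Finset.sum_range_succ']
  simp [eGrp, adIter]

theorem bd_deriv (c : ℝ) (m : ℕ) (s : ℝ) :
    HasDerivAt (fun s : ℝ => s ^ (m + 1) * (((m + 1).factorial : ℝ))⁻¹ * c)
      (s ^ m * ((m.factorial : ℝ))⁻¹ * c) s := by
  have h2 := (((hasDerivAt_id s).pow (m + 1)).mul_const (((m + 1).factorial : ℝ))⁻¹).mul_const c
  refine h2.congr_deriv ?_
  have : ((m : ℝ) + 1) ≠ 0 := Nat.cast_add_one_ne_zero m
  have : (m.factorial : ℝ) ≠ 0 := by exact_mod_cast m.factorial_ne_zero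
  rw [Nat.factorial_succ]
  push_cast
  simp only [id]
  field_simp

theorem tRem_bound (A : H →L[ℂ] H) (hA : IsSelfAdjoint A) (m : ℕ) :
    ∀ (B : H →L[ℂ] H) (s : ℝ),
      ‖tRem A B m s‖ ≤ |s| ^ m * ((m.factorial : ℝ))⁻¹ * ‖adIter A B m‖ := by
  induction m with
  | zero =>
    intro B s
    simp only [tRem, Finset.range_zero, Finset.sum_empty, sub_zero, pow_zero, Nat.factorial_zero,
      Nat.cast_one, inv_one, one_mul, adIter]
    rw [CStarRing.norm_mul_mem_unitary _ (eGrp_mem A hA _),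
      CStarRing.norm_mem_unitary_mul _ (eGrp_mem A hA _)]
  | succ m ih =>
    intro B s
    have key : ∀ x : ℝ, ‖(-Complex.I) • tRem A (B * A - A * B) m x‖ ≤
        |x| ^ m * ((m.factorial : ℝ))⁻¹ * ‖adIter A B (m + 1)‖ := by
      intro x
      rw [norm_smul, norm_neg, Complex.norm_I, one_mul, ← adIter_shift]
      exact ih _ x
    rcases le_total 0 s with hs | hs
    · have := image_norm_le_of_norm_deriv_right_le_deriv_boundary (a := 0) (b := s)
        (f := tRem A B (m + 1)) (f' := fun x => (-Complex.I) • tRem A (B * A - A * B) m x)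
        (fun x _ => (tRem_deriv A B m x).continuousAt.continuousWithinAt)
        (fun x _ => (tRem_deriv A B m x).hasDerivWithinAt)
        (by simp [tRem_zero]) (bd_deriv ‖adIter A B (m + 1)‖ m)
        (fun x hx => by
          have := key x
          rwa [abs_of_nonneg hx.1] at this) (Set.right_mem_Icc.2 hs)
      rwa [abs_of_nonneg hs]
    · have hd : ∀ x : ℝ, HasDerivAt (fun t : ℝ => tRem A B (m + 1) (-t))
          (-((-Complex.I) • tRem A (B * A - A * B) m (-x))) x := by
        intro x
        have h := (tRem_deriv A B m (-x)).scomp x (hasDerivAt_neg x)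
        simpa [Function.comp_def] using! h
      have := image_norm_le_of_norm_deriv_right_le_deriv_boundary (a := 0) (b := -s)
        (f := fun t : ℝ => tRem A B (m + 1) (-t))
        (fun x _ => (hd x).continuousAt.continuousWithinAt)
        (fun x _ => (hd x).hasDerivWithinAt)
        (by simp [tRem_zero]) (bd_deriv ‖adIter A B (m + 1)‖ m)
        (fun x hx => by
          have := key (-x)
          rw [abs_neg, abs_of_nonneg hx.1] at this
          rwa [norm_neg]) (Set.right_mem_Icc.2 (neg_nonneg.2 hs))
      rw [abs_of_nonpos hs]
      simpa only [neg_neg] using this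

theorem int_aux (A : H →L[ℂ] H) (hA : IsSelfAdjoint A) (g : ℝ → ℂ) (hmeas : Measurable g) (k : ℕ)
    (hk : Integrable (fun s : ℝ => ‖g s‖ * |s| ^ k)) :
    Integrable (fun s : ℝ => (g s * (Complex.I * s) ^ k) • eGrp A s) := by
  have hc : Continuous (eGrp A) :=
    continuous_iff_continuousAt.2 fun s => (eGrp_deriv A s).continuousAt
  refine hk.mono' ?_ ?_
  · have h : AEStronglyMeasurable (fun s : ℝ => g s * (Complex.I * s) ^ k) volume :=
      (hmeas.mul (by fun_prop)).aestronglyMeasurable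
    exact h.smul hc.aestronglyMeasurable
  · refine Filter.Eventually.of_forall fun s => ?_
    rw [norm_smul]
    have : ‖g s * (Complex.I * s) ^ k‖ = ‖g s‖ * |s| ^ k := by simp
    rw [this]
    exact mul_le_of_le_one_right (by positivity) (eGrp_norm A hA s)

theorem pointwise_aux (A B : H →L[ℂ] H) (n : ℕ) (s : ℝ) (z : ℂ) :
    (B * (z • eGrp A s) - (z • eGrp A s) * B) -
      ∑ k ∈ Finset.Icc 1 n, (((-1 : ℂ)) ^ (k - 1) * ((k.factorial : ℂ))⁻¹) •
          (adIter A B k * ((z * (Complex.I * s) ^ k) • eGrp A s))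
      = -(z • (tRem A B (n + 1) s * eGrp A s)) := by
  have hI : Finset.Icc 1 n = Finset.Ico 1 (n + 1) := by ext; simp
  rw [hI, Finset.sum_Ico_eq_sum_range, tRem, Finset.sum_range_succ', sub_mul,
    mul_assoc _ (eGrp A (-s)), eGrp_neg_mul, mul_one, add_mul, Finset.sum_mul, smul_sub, smul_add,
    Finset.smul_sum]
  simp only [pow_zero, Nat.factorial_zero, Nat.cast_one, inv_one, mul_one, one_smul, adIter,
    Nat.add_sub_cancel, mul_smul_comm, smul_mul_assoc, smul_smul]
  have : ∀ k : ℕ, ((-1 : ℂ) ^ (1 + k - 1) * (((1 + k).factorial : ℂ))⁻¹ *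
        (z * (Complex.I * s) ^ (1 + k))) • (adIter A B (1 + k) * eGrp A s)
      = -((z * ((-(Complex.I * s)) ^ (k + 1) * (((k + 1).factorial : ℂ))⁻¹)) •
        (adIter A B (k + 1) * eGrp A s)) := by
    intro k
    rw [add_comm 1 k, ← neg_smul, neg_pow (Complex.I * (s : ℂ))]
    congr 1
    simp only [Nat.add_sub_cancel, pow_succ (-1 : ℂ)]
    ring
  simp only [this, Finset.sum_neg_distrib, adIter]
  abel

end Helpers

/-- With `f_g(A) = ∫ g(s) exp(isA) ds` and
`f_g^(k)(A) = ∫ g(s) (is)^k exp(isA) ds`, for `A` bounded self-adjoint, `B` bounded, `n ≥ 1`,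
and `g` measurable with `∫ |g(s)||s|^k ds < ∞` for all `0 ≤ k ≤ n`:
`‖[B, f_g(A)] - Σ_{k=1}^{n-1} ((-1)^{k-1}/k!) ad_A^(k)(B) f_g^(k)(A)‖
  ≤ (1/n!) ‖ad_A^(n)(B)‖ ∫ |g(s)||s|^n ds`. -/
theorem commutator_smoothFn_adjoint_expansion_bound
    {H : Type*} [NormedAddCommGroup H] [InnerProductSpace ℂ H] [CompleteSpace H]
    (A B : H →L[ℂ] H) (hA : IsSelfAdjoint A) (n : ℕ) (hn : 1 ≤ n)
    (g : ℝ → ℂ) (hmeas : Measurable g)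
    (hg : ∀ k : ℕ, k ≤ n → Integrable (fun s : ℝ => ‖g s‖ * |s| ^ k)) :
    ‖(B * (∫ s : ℝ, g s • NormedSpace.exp ((Complex.I * s) • A))
        - (∫ s : ℝ, g s • NormedSpace.exp ((Complex.I * s) • A)) * B)
      - ∑ k ∈ Finset.Icc 1 (n - 1), (((-1 : ℂ)) ^ (k - 1) * ((k.factorial : ℂ))⁻¹) •
          (adIter A B k *
            ∫ s : ℝ, (g s * (Complex.I * s) ^ k) • NormedSpace.exp ((Complex.I * s) • A))‖
      ≤ ((n.factorial : ℝ))⁻¹ * ‖adIter A B n‖ * ∫ s : ℝ, ‖g s‖ * |s| ^ n := by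
  obtain ⟨m, rfl⟩ : ∃ m, n = m + 1 := ⟨n - 1, by omega⟩
  rw [Nat.add_sub_cancel]
  have hi : ∀ k ≤ m + 1, Integrable (fun s : ℝ => (g s * (Complex.I * s) ^ k) • eGrp A s) :=
    fun k hk => int_aux A hA g hmeas k (hg k hk)
  have h0 : Integrable (fun s : ℝ => g s • eGrp A s) := by
    simpa using hi 0 (Nat.zero_le _)
  have hik : ∀ k ∈ Finset.Icc 1 m, Integrable (fun s : ℝ =>
      (((-1 : ℂ)) ^ (k - 1) * ((k.factorial : ℂ))⁻¹) •
          (adIter A B k * ((g s * (Complex.I * s) ^ k) • eGrp A s))) := fun k hk =>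
    ((hi k (by have := (Finset.mem_Icc.1 hk).2; omega)).const_mul (adIter A B k)).fun_smul _
  have hl := h0.const_mul B
  have hr := h0.mul_const B
  have hlr : Integrable (fun s : ℝ => B * (g s • eGrp A s) - (g s • eGrp A s) * B) := hl.sub hr
  have e : (B * (∫ s : ℝ, g s • NormedSpace.exp ((Complex.I * s) • A))
        - (∫ s : ℝ, g s • NormedSpace.exp ((Complex.I * s) • A)) * B)
      - ∑ k ∈ Finset.Icc 1 m, (((-1 : ℂ)) ^ (k - 1) * ((k.factorial : ℂ))⁻¹) •
          (adIter A B k *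
            ∫ s : ℝ, (g s * (Complex.I * s) ^ k) • NormedSpace.exp ((Complex.I * s) • A))
      = ∫ s : ℝ, -(g s • (tRem A B (m + 1) s * eGrp A s)) := by
    simp only [← pointwise_aux]
    rw [integral_sub hlr (integrable_finsetSum _ hik), integral_sub hl hr,
      integral_finsetSum _ hik, integral_const_mul_of_integrable h0,
      integral_mul_const_of_integrable h0]
    congr 1
    refine Finset.sum_congr rfl fun k hk => ?_
    rw [integral_smul, integral_const_mul_of_integrable
      (hi k (by have := (Finset.mem_Icc.1 hk).2; omega))]
    rfl
  rw [e, ← integral_const_mul]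
  refine norm_integral_le_of_norm_le ((hg _ le_rfl).const_mul _)
    (Filter.Eventually.of_forall fun s => ?_)
  rw [norm_neg, norm_smul, CStarRing.norm_mul_mem_unitary _ (eGrp_mem A hA _)]
  calc _ ≤ ‖g s‖ * (|s| ^ (m + 1) * (((m + 1).factorial : ℝ))⁻¹ * ‖adIter A B (m + 1)‖) := by
        gcongr
        exact tRem_bound A hA (m + 1) B s
    _ = _ := by ring
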